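/- Let G₀ = ℤ/2 ⋆ ℤ/3 with canonical generators a (of order 2) and b (of order 3), and set x = (ba)²·(b²a)·(ba)⁻² and y = b²a. Then the subgroup H of G₀ generated by {x, y} has index 6 in G₀, and {x, y} is a free basis of H, i.e., the homomorphism from the free group on two generators to G₀ sending the two generators to x and y is injective with range equal to H. -/

import Mathlib

/-- The free product ℤ/2 ⋆ ℤ/3. -/
abbrev G₀ : Type :=
  Monoid.Coprod (Multiplicative (ZMod 2)) (Multiplicative (ZMod 3))

/-- The canonical generator `a` of the first factor (of order 2). -/
def genA : G₀ := Monoid.Coprod.inl (Multiplicative.ofAdd 1)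

/-- The canonical generator `b` of the second factor (of order 3). -/
def genB : G₀ := Monoid.Coprod.inr (Multiplicative.ofAdd 1)

/-- The hom out of `ℤ/n` (written multiplicatively) sending the generator to `g`, if `g ^ n = 1`. -/
def zmodHom {M : Type*} [Group M] (n : ℕ) (g : M) (hg : g ^ n = 1) :
    Multiplicative (ZMod n) →* M :=
  AddMonoidHom.toMultiplicativeLeft
    (ZMod.lift n ⟨zmultiplesHom (Additive M) (Additive.ofMul g), by
      simpa using congrArg Additive.ofMul hg⟩)

theorem zmodHom_ofAdd_one {M : Type*} [Group M] (n : ℕ) (g : M) (hg : g ^ n = 1) :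
    zmodHom n g hg (Multiplicative.ofAdd 1) = g := by
  have h := ZMod.lift_coe n (⟨zmultiplesHom (Additive M) (Additive.ofMul g), by
    simpa using congrArg Additive.ofMul hg⟩ : {f : ℤ →+ Additive M // f n = 0}) 1
  simp only [Int.cast_one] at h
  simp [zmodHom, h]

theorem genA_mul_self : genA * genA = 1 := by
  rw [genA, ← map_mul, ← map_one Monoid.Coprod.inl]
  exact congrArg _ (by decide)

theorem genB_mul_self_mul_self : genB * (genB * genB) = 1 := by
  rw [genB, ← map_mul, ← map_mul, ← map_one Monoid.Coprod.inr]
  exact congrArg _ (by decide)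

theorem G₀.induction_generators {P : G₀ → Prop} (one : P 1) (a : P genA) (b : P genB)
    (mul : ∀ g h, P g → P h → P (g * h)) (g : G₀) : P g := by
  induction g using Monoid.Coprod.induction_on with
  | inl m =>
    obtain rfl | rfl : m = 1 ∨ m = Multiplicative.ofAdd 1 := by revert m; decide
    · simpa using one
    · exact a
  | inr m =>
    obtain rfl | rfl | rfl : m = 1 ∨ m = Multiplicative.ofAdd 1 ∨
        m = Multiplicative.ofAdd 1 * Multiplicative.ofAdd 1 := by revert m; decide
    · simpa using one
    · exact b
    · rw [map_mul]
      exact mul _ _ b b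
  | mul g h hg hh => exact mul g h hg hh

/-- The element `x = (ba)² (b²a) (ba)⁻²`. -/
def genX : G₀ := (genB * genA) ^ 2 * (genB ^ 2 * genA) * ((genB * genA) ^ 2)⁻¹

/-- The element `y = b²a`. -/
def genY : G₀ := genB ^ 2 * genA

theorem genA_inv : genA⁻¹ = genA := inv_eq_of_mul_eq_one_left genA_mul_self

theorem genB_inv : genB⁻¹ = genB * genB := inv_eq_of_mul_eq_one_right genB_mul_self_mul_self

theorem genA_mul_genA_mul (g : G₀) : genA * (genA * g) = g := by
  rw [← mul_assoc, genA_mul_self, one_mul]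

theorem genB_mul_genB_mul_genB_mul (g : G₀) : genB * (genB * (genB * g)) = g := by
  rw [← mul_assoc, ← mul_assoc, mul_assoc genB, genB_mul_self_mul_self, one_mul]

/-- The hom from the free group sending the generators to `x` and `y`. -/
def freeHom : FreeGroup (Fin 2) →* G₀ := FreeGroup.lift ![genX, genY]

/-- Representatives of the left cosets of `⟨x, y⟩`. -/
def cosetRep : Fin 6 → G₀ :=
  ![1, genB, genB * genB, genA * (genB * genB), genB * (genA * (genB * genB)),
    genB * (genB * (genA * (genB * genB)))]

/-- Left multiplication by `a`, in the coordinates `(w, i) ↦ cosetRep i * freeHom w`. -/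
def actA : FreeGroup (Fin 2) × Fin 6 → FreeGroup (Fin 2) × Fin 6
  | (w, 0) => (FreeGroup.of 1 * w, 1)
  | (w, 1) => ((FreeGroup.of 1)⁻¹ * w, 0)
  | (w, 2) => (w, 3)
  | (w, 3) => (w, 2)
  | (w, 4) => (FreeGroup.of 0 * w, 5)
  | (w, 5) => ((FreeGroup.of 0)⁻¹ * w, 4)

/-- Left multiplication by `b`, in the coordinates `(w, i) ↦ cosetRep i * freeHom w`. -/
def actB : FreeGroup (Fin 2) × Fin 6 → FreeGroup (Fin 2) × Fin 6
  | (w, i) => (w, ![1, 2, 0, 4, 5, 3] i)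

theorem actA_actA (p : FreeGroup (Fin 2) × Fin 6) : actA (actA p) = p := by
  obtain ⟨w, i⟩ := p
  fin_cases i <;> simp [actA]

theorem actB_actB_actB (p : FreeGroup (Fin 2) × Fin 6) : actB (actB (actB p)) = p := by
  obtain ⟨w, i⟩ := p
  fin_cases i <;> rfl

/-- `actA` as a permutation. -/
def permA : Equiv.Perm (FreeGroup (Fin 2) × Fin 6) := ⟨actA, actA, actA_actA, actA_actA⟩

/-- `actB` as a permutation. -/
def permB : Equiv.Perm (FreeGroup (Fin 2) × Fin 6) :=
  ⟨actB, fun p => actB (actB p), actB_actB_actB, actB_actB_actB⟩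

/-- The action of `G₀` on `F₂ × {0, …, 5}` with `a` and `b` acting by `actA` and `actB`. -/
def cosetAction : G₀ →* Equiv.Perm (FreeGroup (Fin 2) × Fin 6) :=
  Monoid.Coprod.lift
    (zmodHom 2 permA (Equiv.ext fun p => actA_actA p))
    (zmodHom 3 permB (Equiv.ext fun p => actB_actB_actB p))

theorem cosetAction_genA (p : FreeGroup (Fin 2) × Fin 6) : cosetAction genA p = actA p := by
  rw [cosetAction, genA, Monoid.Coprod.lift_apply_inl, zmodHom_ofAdd_one]
  rfl

theorem cosetAction_genB (p : FreeGroup (Fin 2) × Fin 6) : cosetAction genB p = actB p := by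
  rw [cosetAction, genB, Monoid.Coprod.lift_apply_inr, zmodHom_ofAdd_one]
  rfl

/-- The element of `G₀` with coordinates `(w, i)`. -/
def ofCoords (p : FreeGroup (Fin 2) × Fin 6) : G₀ := cosetRep p.2 * freeHom p.1

theorem genX_eq : genX = genB * (genA * (genB * (genA * (genB * (genA * (genB * genB)))))) := by
  simp [genX, pow_succ, mul_assoc, genA_inv, genB_inv, genA_mul_genA_mul,
    genB_mul_genB_mul_genB_mul]

theorem genY_eq : genY = genB * (genB * genA) := by
  simp [genY, pow_succ, mul_assoc]

theorem ofCoords_actA (p : FreeGroup (Fin 2) × Fin 6) :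
    ofCoords (actA p) = genA * ofCoords p := by
  obtain ⟨w, i⟩ := p
  fin_cases i <;>
    simp [actA, ofCoords, cosetRep, freeHom, genX_eq, genY_eq, mul_assoc, genA_inv, genB_inv,
      genA_mul_genA_mul, genB_mul_genB_mul_genB_mul]

theorem ofCoords_actB (p : FreeGroup (Fin 2) × Fin 6) :
    ofCoords (actB p) = genB * ofCoords p := by
  obtain ⟨w, i⟩ := p
  fin_cases i <;>
    simp [actB, ofCoords, cosetRep, mul_assoc, genB_mul_genB_mul_genB_mul]

theorem ofCoords_cosetAction (g : G₀) :
    ∀ p, ofCoords (cosetAction g p) = g * ofCoords p := by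
  induction g using G₀.induction_generators with
  | one => simp
  | a => intro p; rw [cosetAction_genA, ofCoords_actA]
  | b => intro p; rw [cosetAction_genB, ofCoords_actB]
  | mul g h hg hh => intro p; rw [map_mul, Equiv.Perm.mul_apply, hg, hh, mul_assoc]

theorem ofCoords_surjective : Function.Surjective ofCoords := fun g =>
  ⟨cosetAction g (1, 0), by rw [ofCoords_cosetAction]; simp [ofCoords, cosetRep]⟩

theorem cosetAction_freeHom (w : FreeGroup (Fin 2)) :
    ∀ v, cosetAction (freeHom w) (v, 0) = (w * v, 0) := by
  induction w using FreeGroup.induction_on with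
  | C1 => simp
  | of i =>
    intro v
    fin_cases i <;>
      simp [freeHom, genX_eq, genY_eq, cosetAction_genA, cosetAction_genB, actA, actB]
  | inv_of i ih =>
    intro v
    rw [map_inv, map_inv, Equiv.Perm.inv_eq_iff_eq, ih, mul_inv_cancel_left]
  | mul u w hu hw => intro v; rw [map_mul, map_mul, Equiv.Perm.mul_apply, hw, hu, mul_assoc]

theorem cosetAction_ofCoords (p : FreeGroup (Fin 2) × Fin 6) :
    cosetAction (ofCoords p) (1, 0) = p := by
  obtain ⟨w, i⟩ := p
  rw [ofCoords, map_mul, Equiv.Perm.mul_apply, cosetAction_freeHom, mul_one]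
  fin_cases i <;> simp [cosetRep, cosetAction_genA, cosetAction_genB, actA, actB]

theorem ofCoords_injective : Function.Injective ofCoords :=
  Function.LeftInverse.injective (g := fun g => cosetAction g (1, 0)) cosetAction_ofCoords

theorem freeHom_injective : Function.Injective freeHom := fun u w h => by
  have := @ofCoords_injective (u, 0) (w, 0) (by simp [ofCoords, h])
  simpa using this

theorem freeHom_range : freeHom.range = Subgroup.closure {genX, genY} := by
  rw [freeHom, FreeGroup.range_lift_eq_closure, Matrix.range_cons, Matrix.range_cons,
    Matrix.range_empty, Set.union_empty, Set.singleton_union]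

theorem index_freeHom_range : freeHom.range.index = 6 := by
  have hbij : Function.Bijective fun i : Fin 6 => (cosetRep i : G₀ ⧸ freeHom.range) := by
    constructor
    · intro i j hij
      obtain ⟨w, hw⟩ := QuotientGroup.eq.mp hij
      have := @ofCoords_injective (w, i) (1, j) (by simp [ofCoords, hw])
      exact congrArg Prod.snd this
    · intro q
      obtain ⟨g, rfl⟩ := QuotientGroup.mk_surjective q
      obtain ⟨⟨w, i⟩, rfl⟩ := ofCoords_surjective g
      exact ⟨i, QuotientGroup.eq.mpr ⟨w, by simp [ofCoords]⟩⟩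
  rw [Subgroup.index, ← Nat.card_congr (Equiv.ofBijective _ hbij), Nat.card_fin]

theorem stmt_17 (a b : G₀) (ha : a = genA) (hb : b = genB)
    (x y : G₀) (hx : x = (b * a) ^ 2 * (b ^ 2 * a) * ((b * a) ^ 2)⁻¹)
    (hy : y = b ^ 2 * a)
    (H : Subgroup G₀) (hH : H = Subgroup.closure {x, y}) :
    H.index = 6 ∧
    ∃ φ : FreeGroup (Fin 2) →* G₀,
      φ (FreeGroup.of 0) = x ∧ φ (FreeGroup.of 1) = y ∧
      Function.Injective φ ∧ φ.range = H := by
  subst ha hb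
  obtain rfl : x = genX := hx
  obtain rfl : y = genY := hy
  rw [← freeHom_range] at hH
  subst hH
  exact ⟨index_freeHom_range, freeHom, by simp [freeHom], by simp [freeHom],
    freeHom_injective, rfl⟩
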